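/- Let K be a totally real number field of degree n ≥ 12 over ℚ, with regulator R_K, and suppose K is A-reducible for some A ≥ 1. Then for every totally positive a ∈ K, min_{u ∈ O_K^×} Tr_{K/ℚ}(a u²) ≤ exp( √( η² + 4·(log A)²/(n-1) ) ) · μ(a), where η = (√(n-1)/2) · (2/π)^{n-1} · Γ(2 + (n-1)/2)² · ( √(2/n) · (1/1000) · ((log log n)/(log n))³ )^{2-n} · R_K. -/

import Mathlib

open NumberField Real

/-- An element of a number field is *totally positive* if it is positive under
every real embedding. -/
def TotPos {K : Type*} [Field K] (a : K) : Prop := ∀ φ : K →+* ℝ, 0 < φ a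

/-- The value of the trace form `Tr_{K/ℚ}(a x²)` at an algebraic integer `x`. -/
noncomputable def trForm {K : Type*} [Field K] [NumberField K] (a : K) (x : 𝓞 K) : ℚ :=
  Algebra.trace ℚ K (a * (x : K) ^ 2)

/-- `μ(a)`: the minimum of `Tr_{K/ℚ}(a x²)` over nonzero `x ∈ 𝓞 K`. -/
noncomputable def muMin {K : Type*} [Field K] [NumberField K] (a : K) : ℝ :=
  sInf {t : ℝ | ∃ x : 𝓞 K, x ≠ 0 ∧ (trForm a x : ℝ) = t}

/-- `M(a)`: the set of algebraic integers attaining `μ(a)`. -/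
def MinVecs {K : Type*} [Field K] [NumberField K] (a : K) : Set (𝓞 K) :=
  {x | ((trForm a x : ℚ) : ℝ) = muMin a}

/-- A totally positive `a` is *perfect* if it is the unique totally positive element `b`
with `Tr(b x²) = μ(a)` for all `x ∈ M(a)`. -/
def IsPerfectForm {K : Type*} [Field K] [NumberField K] (a : K) : Prop :=
  TotPos a ∧ ∀ b : K, TotPos b → (∀ x ∈ MinVecs a, ((trForm b x : ℚ) : ℝ) = muMin a) → b = a

/-- `a ~ a'` : equivalence by squares of units. -/
def UnitEquiv {K : Type*} [Field K] [NumberField K] (a a' : K) : Prop :=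
  ∃ u : (𝓞 K)ˣ, a' = a * ((u : 𝓞 K) : K) ^ 2

/-- Homothety: `a` and `b` are homothetic if `λ a ~ b` for some positive rational `λ`. -/
def Homothetic {K : Type*} [Field K] [NumberField K] (a b : K) : Prop :=
  ∃ q : ℚ, 0 < q ∧ UnitEquiv ((q : K) * a) b

/-- The number of homothety classes of perfect unary forms of `K`. -/
noncomputable def numClasses (K : Type*) [Field K] [NumberField K] : ℕ :=
  Nat.card (Quot (fun a b : {a : K // IsPerfectForm a} => Homothetic (a : K) (b : K)))

/-- `K` is `A`-reducible if minimal vectors of totally positive elements have norm at most `A`. -/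
def IsAReducible (K : Type*) [Field K] [NumberField K] (A : ℝ) : Prop :=
  ∀ a : K, TotPos a → ∀ x ∈ MinVecs a, |(Algebra.norm ℚ (x : K) : ℝ)| ≤ A

/-- `K` is totally real if every infinite place is real. -/
def TotallyReal (K : Type*) [Field K] [NumberField K] : Prop :=
  ∀ v : NumberField.InfinitePlace K, v.IsReal

/-- A bound for the covering radius of a lattice in terms of its covolume and its minimum, for
the sup norm: balls of radius `δ / 2` about points at distance `k * δ` from the lattice pack. -/
theorem ZLattice.exists_dist_lt_covolume_div {ι : Type*} [Fintype ι] (L : Submodule ℤ (ι → ℝ))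
    [DiscreteTopology L] [IsZLattice ℝ L] {δ : ℝ} (hδ : 0 < δ)
    (hL : ∀ v ∈ L, ‖v‖ < δ → v = 0) (t : ι → ℝ) :
    ∃ v ∈ L, dist t v < ZLattice.covolume L / δ ^ Fintype.card ι * δ := by
  have hne : (L : Set (ι → ℝ)).Nonempty := ⟨0, L.zero_mem⟩
  set f : (ι → ℝ) → ℝ := fun x ↦ Metric.infDist x (L : Set (ι → ℝ)) with hf
  have hadd : ∀ x, ∀ v ∈ L, f (v + x) ≤ f x := by
    intro x v hv
    refine (Metric.le_infDist hne).2 fun {y} hy ↦ ?_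
    rw [← dist_add_left v x y]
    exact Metric.infDist_le_dist_of_mem (L.add_mem hv hy)
  set m : ℕ := ⌊f t / δ⌋₊ + 1 with hm
  have hft : 0 ≤ f t := Metric.infDist_nonneg
  have hpt : ∀ k : Fin m, ∃ p : ι → ℝ, f p = k * δ := by
    intro k
    have hcont : Continuous fun s : ℝ ↦ f (s • t) :=
      (Metric.continuous_infDist_pt _).comp (by fun_prop)
    have h0 : f ((0 : ℝ) • t) = 0 := by
      rw [zero_smul]; exact Metric.infDist_zero_of_mem L.zero_mem
    have hk : (k : ℝ) * δ ≤ f t := by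
      rw [← le_div_iff₀ hδ]
      exact (Nat.cast_le.2 (Nat.lt_succ_iff.1 k.2)).trans (Nat.floor_le (by positivity))
    obtain ⟨s, -, hs⟩ := intermediate_value_Icc zero_le_one hcont.continuousOn
      (show (k : ℝ) * δ ∈ _ by rw [h0, one_smul]; exact ⟨by positivity, hk⟩)
    exact ⟨_, hs⟩
  choose p hp using hpt
  have hclose : ∀ i j : Fin m, ∀ q ∈ Metric.ball (p i) (δ / 2), ∀ q' ∈ Metric.ball (p j) (δ / 2),
      ∀ x ∈ L, ∀ y ∈ L, x + q = y + q' → i = j ∧ x = y := by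
    intro i j q hq q' hq' x hx y hy hxy
    have hqq : f q = f q' := by
      apply le_antisymm
      · have := hadd q' (-x + y) (L.add_mem (L.neg_mem hx) hy)
        rwa [show -x + y + q' = q by rw [add_assoc, ← hxy]; abel] at this
      · have := hadd q (-y + x) (L.add_mem (L.neg_mem hy) hx)
        rwa [show -y + x + q = q' by rw [add_assoc, hxy]; abel] at this
    rw [Metric.mem_ball] at hq hq'
    have h1 : f q ≤ f (p i) + dist q (p i) := Metric.infDist_le_infDist_add_dist
    have h2 : f (p i) ≤ f q + dist (p i) q := Metric.infDist_le_infDist_add_dist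
    have h3 : f q' ≤ f (p j) + dist q' (p j) := Metric.infDist_le_infDist_add_dist
    have h4 : f (p j) ≤ f q' + dist (p j) q' := Metric.infDist_le_infDist_add_dist
    rw [dist_comm] at h2 h4
    rw [hp] at h1 h2 h3 h4
    have hij : i = j := by
      have h5 : (i : ℝ) < j + 1 := by
        by_contra! h; nlinarith
      have h6 : (j : ℝ) < i + 1 := by
        by_contra! h; nlinarith
      norm_cast at h5 h6
      omega
    subst hij
    refine ⟨rfl, sub_eq_zero.1 (hL _ (L.sub_mem hx hy) ?_)⟩
    rw [show x - y = q' - q by rw [sub_eq_sub_iff_add_eq_add, hxy, add_comm], ← dist_eq_norm]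
    linarith [dist_triangle_right q' q (p i)]
  have hvol : (m : ℝ) * δ ^ Fintype.card ι ≤ ZLattice.covolume L := by
    by_contra! hlt
    have fund := ZLattice.isAddFundamentalDomain (Module.Free.chooseBasis ℤ L) MeasureTheory.volume
    rw [ZLattice.covolume_eq_measure_fundamentalDomain L _ fund] at hlt
    have hmeas : MeasureTheory.volume (⋃ k : Fin m, Metric.ball (p k) (δ / 2)) =
        ENNReal.ofReal (m * δ ^ Fintype.card ι) := by
      rw [MeasureTheory.measure_iUnion]
      · simp_rw [Real.volume_pi_ball _ (half_pos hδ)]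
        rw [tsum_fintype, Finset.sum_const, Finset.card_univ, Fintype.card_fin,
          mul_div_cancel₀ _ (two_ne_zero), nsmul_eq_mul, ENNReal.ofReal_mul (by positivity),
          ENNReal.ofReal_natCast]
      · intro i j hij
        refine Set.disjoint_left.2 fun q hq hq' ↦ hij ?_
        exact (hclose i j q hq q hq' 0 L.zero_mem 0 L.zero_mem rfl).1
      · exact fun _ ↦ measurableSet_ball
    have hfin : MeasureTheory.volume
        (ZSpan.fundamentalDomain ((Module.Free.chooseBasis ℤ L).ofZLatticeBasis ℝ)) ≠ ⊤ :=
      (ZSpan.fundamentalDomain_isBounded _).measure_lt_top.ne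
    have : MeasurableVAdd L (ι → ℝ) := inferInstanceAs (MeasurableVAdd L.toAddSubgroup (ι → ℝ))
    have : MeasureTheory.VAddInvariantMeasure L (ι → ℝ) MeasureTheory.volume :=
      inferInstanceAs (MeasureTheory.VAddInvariantMeasure L.toAddSubgroup (ι → ℝ) _)
    obtain ⟨x, y, hxy, hd⟩ := MeasureTheory.exists_pair_mem_lattice_not_disjoint_vadd fund
      (s := ⋃ k : Fin m, Metric.ball (p k) (δ / 2))
      (MeasurableSet.iUnion fun _ ↦ measurableSet_ball).nullMeasurableSet
      (by rw [hmeas]; exact (ENNReal.lt_ofReal_iff_toReal_lt hfin).2 hlt)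
    obtain ⟨z, ⟨q, hq, rfl⟩, q', hq', h⟩ := Set.not_disjoint_iff.1 hd
    obtain ⟨i, hi⟩ := Set.mem_iUnion.1 hq
    obtain ⟨j, hj⟩ := Set.mem_iUnion.1 hq'
    exact hxy (Subtype.ext (hclose i j q hi q' hj x x.2 y y.2 h.symm).2)
  have hlt : f t < ZLattice.covolume L / δ ^ Fintype.card ι * δ := by
    have h1 : f t < m * δ := by
      rw [← div_lt_iff₀ hδ, hm]; push_cast; exact Nat.lt_floor_add_one _
    refine h1.trans_le (mul_le_mul_of_nonneg_right ?_ hδ.le)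
    rwa [le_div_iff₀ (by positivity)]
  exact (Metric.infDist_lt_iff hne).1 hlt

theorem abs_exp_two_mul_sub_one_le (l ε : ℝ) (h : |l| ≤ ε) :
    |exp (2 * l) - 1| ≤ exp (2 * ε) - 1 := by
  obtain ⟨h1, h2⟩ := abs_le.1 h
  have h3 : exp (2 * l) ≤ exp (2 * ε) := exp_le_exp.2 (by linarith)
  have h4 : exp (-(2 * ε)) ≤ exp (2 * l) := exp_le_exp.2 (by linarith)
  have h5 : exp (-(2 * ε)) * exp (2 * ε) = 1 := by rw [← exp_add]; simp
  rw [abs_le]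
  refine ⟨?_, by linarith⟩
  nlinarith [sq_nonneg (exp (2 * ε) - 1), exp_pos (-(2 * ε)), exp_pos (2 * ε),
    sq_nonneg (exp (-(2 * ε)) - 1), sq_nonneg (exp (2 * ε) - exp (-(2 * ε)))]

theorem abs_exp_two_mul_sub_one_le_exp (l ε : ℝ) (h : |l| ≤ ε) :
    |exp (2 * l) - 1| ≤ exp (2 * ε) :=
  (abs_exp_two_mul_sub_one_le l ε h).trans (by linarith)

theorem exp_mul_exp_sub_one_lt : exp (2 * (1 / 10 : ℝ)) * (exp (2 * (1 / 10 : ℝ)) - 1) < 1 := by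
  have h : exp (2 * (1 / 10 : ℝ)) ≤ 5 / 4 := by
    have := Real.exp_bound_div_one_sub_of_interval (x := 2 * (1 / 10 : ℝ)) (by norm_num) (by norm_num)
    norm_num at this ⊢
    exact this
  have h' : 1 ≤ exp (2 * (1 / 10 : ℝ)) := one_le_exp (by norm_num)
  nlinarith

open NumberField.Units NumberField.Units.dirichletUnitTheorem

theorem InfinitePlace.abs_sq_sub_one_eq {K : Type*} [Field K] [NumberField K]
    (htr : TotallyReal K) (w : InfinitePlace K) (u : (𝓞 K)ˣ) :
    w ((u : K) ^ 2 - 1) = |exp (2 * log (w (u : K))) - 1| := by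
  have h0 : 0 < w (u : K) := Units.pos_at_place u w
  rw [two_mul, exp_add, exp_log h0, ← InfinitePlace.norm_embedding_of_isReal (htr w),
    ← InfinitePlace.norm_embedding_of_isReal (htr w)]
  simp [Real.norm_eq_abs, sq]

theorem TotallyReal.mult_eq_one {K : Type*} [Field K] [NumberField K]
    (htr : TotallyReal K) (w : InfinitePlace K) : w.mult = 1 :=
  InfinitePlace.mult_isReal ⟨w, htr w⟩

theorem TotallyReal.card_infinitePlace {K : Type*} [Field K] [NumberField K]
    (htr : TotallyReal K) : Fintype.card (InfinitePlace K) = Module.finrank ℚ K := by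
  rw [← InfinitePlace.sum_mult_eq]
  simp [htr.mult_eq_one]

theorem InfinitePlace.one_le_prod {K : Type*} [Field K] [NumberField K]
    (htr : TotallyReal K) (x : 𝓞 K) (hx : x ≠ 0) : 1 ≤ ∏ w : InfinitePlace K, w (x : K) := by
  have h := InfinitePlace.prod_eq_abs_norm (x : K)
  simp only [htr.mult_eq_one, pow_one] at h
  rw [h, ← Algebra.coe_norm_int]
  have h2 : Algebra.norm ℤ x ≠ 0 := by rwa [Ne, Algebra.norm_eq_zero_iff]
  exact_mod_cast Int.one_le_abs h2

open scoped Classical in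
/-- A unit of a totally real field with small logarithms is a root of unity, since the norm of
`u ^ 2 - 1` would otherwise be smaller than `1`. -/
theorem logEmbedding_eq_zero_of_norm_lt {K : Type*} [Field K] [NumberField K]
    (htr : TotallyReal K) (hcard : 2 ≤ Fintype.card (InfinitePlace K)) (u : (𝓞 K)ˣ)
    (hu : ‖logEmbedding K (Additive.ofMul u)‖ < 1 / 10) :
    logEmbedding K (Additive.ofMul u) = 0 := by
  set r := Fintype.card {w : InfinitePlace K // w ≠ w₀} with hr
  have hr1 : r ≠ 0 := by
    rw [hr, Fintype.card_subtype_compl, Fintype.card_subtype_eq]; omega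
  have hl : ∀ w : {w : InfinitePlace K // w ≠ w₀}, |log (w.1 (u : K))| ≤ 1 / 10 := by
    intro w
    have := (norm_le_pi_norm (logEmbedding K (Additive.ofMul u)) w).trans hu.le
    rwa [logEmbedding_component, htr.mult_eq_one, Nat.cast_one, one_mul, Real.norm_eq_abs] at this
  have hl0 : |log ((w₀ : InfinitePlace K) (u : K))| ≤ r * (1 / 10) := by
    have h := sum_logEmbedding_component u
    rw [htr.mult_eq_one, Nat.cast_one, neg_one_mul] at h
    rw [← abs_neg, ← h]
    refine (Finset.abs_sum_le_sum_abs _ _).trans ((Finset.sum_le_card_nsmul _ _ (1 / 10) ?_).trans ?_)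
    · intro w _
      simpa [htr.mult_eq_one] using hl w
    · simp [hr]
  by_cases hsq : (u : 𝓞 K) ^ 2 - 1 = 0
  · have hw : ∀ w : InfinitePlace K, w (u : K) = 1 := by
      intro w
      have h1 : (u : K) ^ 2 = 1 := by
        have := congrArg (algebraMap (𝓞 K) K) (sub_eq_zero.1 hsq)
        simpa using this
      have h2 : w (u : K) ^ 2 = 1 := by rw [← map_pow, h1, map_one]
      exact (pow_eq_one_iff_of_nonneg (apply_nonneg _ _) two_ne_zero).1 h2
    ext w
    simp [hw]
  · exfalso
    have h1 := InfinitePlace.one_le_prod htr _ hsq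
    have h2 : ∏ w : InfinitePlace K, w (((u : 𝓞 K) ^ 2 - 1 : 𝓞 K) : K) =
        ∏ w : InfinitePlace K, |exp (2 * log (w (u : K))) - 1| := by
      refine Finset.prod_congr rfl fun w _ ↦ ?_
      rw [← InfinitePlace.abs_sq_sub_one_eq htr]
      simp
    rw [h2, Fintype.prod_eq_mul_prod_subtype_ne _ (w₀ : InfinitePlace K)] at h1
    have h3 : ∏ w : {w : InfinitePlace K // w ≠ w₀}, |exp (2 * log (w.1 (u : K))) - 1| ≤
        (exp (2 * (1 / 10)) - 1) ^ r := by
      rw [hr, ← Finset.card_univ, ← Finset.prod_const]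
      exact Finset.prod_le_prod (fun _ _ ↦ abs_nonneg _)
        fun w _ ↦ abs_exp_two_mul_sub_one_le _ _ (hl w)
    have h4 := abs_exp_two_mul_sub_one_le_exp _ _ hl0
    have h5 : exp (2 * (r * (1 / 10))) = exp (2 * (1 / 10)) ^ r := by
      rw [← exp_nat_mul]; ring_nf
    have h6 : 0 ≤ exp (2 * (1 / 10 : ℝ)) - 1 := by
      have : 1 ≤ exp (2 * (1 / 10 : ℝ)) := one_le_exp (by norm_num)
      linarith
    have h7 := mul_le_mul h4 h3 (Finset.prod_nonneg fun _ _ ↦ abs_nonneg _) (exp_pos _).le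
    rw [h5, ← mul_pow] at h7
    exact absurd (h1.trans h7) (not_le.2 (pow_lt_one₀ (mul_nonneg (exp_pos _).le h6)
      exp_mul_exp_sub_one_lt hr1))

open scoped Classical in
/-- Every nonzero integer is dominated at all places by a unit, up to a factor depending on the
regulator. -/
theorem exists_unit_place_le {K : Type*} [Field K] [NumberField K] (n : ℕ)
    (hdeg : Module.finrank ℚ K = n) (hn : 2 ≤ n) (htr : TotallyReal K) (x : 𝓞 K) (hx : x ≠ 0) :
    ∃ u : (𝓞 K)ˣ, ∀ w : InfinitePlace K,
      w (u : K) ≤ exp (((n : ℝ) - 1) * (Units.regulator K * 10 ^ (n - 2))) * w (x : K) := by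
  have hc : Fintype.card (InfinitePlace K) = n := htr.card_infinitePlace.trans hdeg
  have hr : Fintype.card {w : InfinitePlace K // w ≠ w₀} = n - 1 := by
    rw [Fintype.card_subtype_compl, Fintype.card_subtype_eq, hc]
  have hn1 : (1 : ℝ) ≤ (n : ℝ) - 1 := by
    have : (2 : ℝ) ≤ n := by exact_mod_cast hn
    linarith
  have hmin : ∀ v ∈ unitLattice K, ‖v‖ < 1 / 10 → v = 0 := by
    rintro _ ⟨u, -, rfl⟩ hu
    exact logEmbedding_eq_zero_of_norm_lt htr (by omega) u.toMul hu
  obtain ⟨v, ⟨u, -, rfl⟩, hv⟩ := ZLattice.exists_dist_lt_covolume_div (unitLattice K)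
    (by norm_num : (0 : ℝ) < 1 / 10) hmin (fun w ↦ log (w.1 (x : K)))
  set ρ := Units.regulator K * 10 ^ (n - 2) with hρ
  have hρ0 : 0 ≤ ρ := mul_nonneg (Units.regulator_pos K).le (by positivity)
  have hbound : ZLattice.covolume (unitLattice K) / (1 / 10) ^ (n - 1) * (1 / 10) = ρ := by
    rw [hρ, show n - 1 = n - 2 + 1 by omega, Units.regulator, pow_succ, one_div, inv_pow]
    field_simp
  rw [hr] at hv
  replace hv := hv.le.trans_eq hbound
  have hu : ∀ w : {w : InfinitePlace K // w ≠ w₀},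
      |log (w.1 (x : K)) - log (w.1 (u.toMul : K))| ≤ ρ := by
    intro w
    have := (dist_le_pi_dist _ _ w).trans hv
    rw [Real.dist_eq] at this
    have h2 := logEmbedding_component u.toMul w
    rw [htr.mult_eq_one, Nat.cast_one, one_mul] at h2
    rw [← h2]
    exact this
  have hxpos : ∀ w : InfinitePlace K, 0 < w (x : K) := fun w ↦
    InfinitePlace.pos_iff.2 (by simpa using hx)
  have hlog : ∀ w : InfinitePlace K,
      log (w (u.toMul : K)) ≤ ((n : ℝ) - 1) * ρ + log (w (x : K)) := by
    intro w
    by_cases hw : w = w₀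
    · subst hw
      have h1 := sum_logEmbedding_component u.toMul
      simp only [logEmbedding_component, htr.mult_eq_one, Nat.cast_one, one_mul, neg_one_mul] at h1
      have h2 : 0 ≤ ∑ w : InfinitePlace K, log (w (x : K)) := by
        rw [← Real.log_prod fun w _ ↦ (hxpos w).ne']
        exact Real.log_nonneg (InfinitePlace.one_le_prod htr x hx)
      rw [Fintype.sum_eq_add_sum_subtype_ne _ (w₀ : InfinitePlace K)] at h2
      have h3 : ∑ w : {w : InfinitePlace K // w ≠ w₀},
          (log (w.1 (x : K)) - log (w.1 (u.toMul : K))) ≤ ((n : ℝ) - 1) * ρ := by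
        refine (Finset.sum_le_card_nsmul _ _ ρ fun w _ ↦ (le_abs_self _).trans (hu w)).trans_eq ?_
        rw [Finset.card_univ, hr, nsmul_eq_mul, Nat.cast_sub (by omega), Nat.cast_one]
      rw [Finset.sum_sub_distrib] at h3
      linarith
    · have := (abs_le.1 (hu ⟨w, hw⟩)).1
      simp only at this
      nlinarith
  refine ⟨u.toMul, fun w ↦ ?_⟩
  rw [← exp_log (Units.pos_at_place u.toMul w), ← exp_log (hxpos w), ← exp_add]
  exact exp_le_exp.2 (by simpa using hlog w)

theorem trForm_eq_sum {K : Type*} [Field K] [NumberField K] (htr : TotallyReal K)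
    (a : K) (x : 𝓞 K) :
    (trForm a x : ℝ) = ∑ φ : K →ₐ[ℚ] ℂ,
      InfinitePlace.embedding_of_isReal (htr (InfinitePlace.mk φ.toRingHom)) a *
        (InfinitePlace.mk φ.toRingHom) (x : K) ^ 2 := by
  have h := trace_eq_sum_embeddings (K := ℚ) ℂ (x := a * (x : K) ^ 2)
  have h2 : ((trForm a x : ℝ) : ℂ) = algebraMap ℚ ℂ (Algebra.trace ℚ K (a * (x : K) ^ 2)) := by
    simp [trForm]
  apply Complex.ofReal_injective
  rw [h2, h, Complex.ofReal_sum]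
  refine Finset.sum_congr rfl fun φ _ ↦ ?_
  have hφ : ∀ y : K, ((InfinitePlace.embedding_of_isReal
      (htr (InfinitePlace.mk φ.toRingHom)) y : ℝ) : ℂ) = φ y := by
    intro y
    rw [InfinitePlace.embedding_of_isReal_apply,
      InfinitePlace.embedding_mk_eq_of_isReal (InfinitePlace.isReal_mk_iff.1 (htr _))]
    rfl
  rw [← InfinitePlace.norm_embedding_of_isReal (htr _), Real.norm_eq_abs, sq_abs]
  push_cast
  rw [hφ, hφ, map_mul, map_pow]

theorem trForm_nonneg {K : Type*} [Field K] [NumberField K] (htr : TotallyReal K)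
    (a : K) (ha : TotPos a) (x : 𝓞 K) : 0 ≤ trForm a x := by
  have : 0 ≤ (trForm a x : ℝ) := by
    rw [trForm_eq_sum htr]
    exact Finset.sum_nonneg fun φ _ ↦ mul_nonneg (ha _).le (sq_nonneg _)
  exact_mod_cast this

/-- The minimum `μ(a)` is attained. -/
theorem exists_min_trForm {K : Type*} [Field K] [NumberField K] (htr : TotallyReal K)
    (a : K) (ha : TotPos a) : ∃ x : 𝓞 K, x ≠ 0 ∧ (trForm a x : ℝ) ≤ muMin a := by
  obtain ⟨d, hd, hint⟩ := IsAlgebraic.exists_integral_multiple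
    ((IsFractionRing.isAlgebraic_iff ℤ ℚ K).2 (Algebra.IsAlgebraic.isAlgebraic a))
  have hN : ∀ x : 𝓞 K, ∃ m : ℕ, (m : ℚ) = |(d : ℚ)| * trForm a x := by
    intro x
    have h1 : IsIntegral ℤ (d • a * (x : K) ^ 2) := hint.mul (x.isIntegral_coe.pow 2)
    obtain ⟨m, hm⟩ := IsIntegrallyClosed.isIntegral_iff.1 (Algebra.isIntegral_trace (L := ℚ) h1)
    refine ⟨m.natAbs, ?_⟩
    have h2 : (m : ℚ) = d * trForm a x := by
      rw [trForm, ← zsmul_eq_mul, ← map_zsmul, ← smul_mul_assoc, ← hm]; simp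
    rw [Nat.cast_natAbs, Int.cast_abs, h2, abs_mul, abs_of_nonneg (trForm_nonneg htr a ha x)]
  choose f hf using hN
  obtain ⟨x, hx, hmin⟩ := (measure f).wf.has_min {x : 𝓞 K | x ≠ 0} ⟨1, one_ne_zero⟩
  refine ⟨x, hx, le_csInf ⟨_, 1, one_ne_zero, rfl⟩ ?_⟩
  rintro _ ⟨y, hy, rfl⟩
  have h1 : f x ≤ f y := not_lt.1 (hmin y hy)
  have h2 : (f x : ℚ) ≤ f y := by exact_mod_cast h1
  rw [hf, hf] at h2
  exact_mod_cast le_of_mul_le_mul_left h2 (by positivity)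

theorem ten_pow_le_eta (n : ℕ) (hn : 12 ≤ n) :
    2 * ((n : ℝ) - 1) * 10 ^ (n - 2) ≤
      Real.sqrt ((n : ℝ) - 1) / 2 * (2 / π) ^ (n - 1) *
        Real.Gamma (2 + ((n : ℝ) - 1) / 2) ^ 2 *
          (Real.sqrt (2 / (n : ℝ)) * (1 / 1000) *
            (Real.log (Real.log (n : ℝ)) / Real.log (n : ℝ)) ^ 3) ^ ((2 : ℝ) - (n : ℝ)) := by
  have hnR : (12 : ℝ) ≤ n := by exact_mod_cast hn
  set δ := Real.sqrt (2 / (n : ℝ)) * (1 / 1000) *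
    (Real.log (Real.log (n : ℝ)) / Real.log (n : ℝ)) ^ 3 with hδ
  have hlog : 1 < Real.log n := by
    rw [Real.lt_log_iff_exp_lt (by linarith)]
    linarith [Real.exp_one_lt_d9]
  have hll : 0 < Real.log (Real.log n) := Real.log_pos hlog
  have hδ0 : 0 < δ := by positivity
  have hδ1 : δ ≤ 1 / 1000 := by
    have h1 : Real.sqrt (2 / (n : ℝ)) ≤ 1 := by
      rw [Real.sqrt_le_one, div_le_one (by linarith)]; linarith
    have h2 : Real.log (Real.log n) / Real.log n ≤ 1 := by
      rw [div_le_one (by linarith)]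
      exact Real.log_le_self (by linarith)
    have h3 := pow_le_one₀ (n := 3) (by positivity) h2
    have h4 := mul_le_mul h1 h3 (by positivity) zero_le_one
    rw [hδ]; linarith
  obtain ⟨k, rfl⟩ : ∃ k, n = k + 2 := ⟨n - 2, by omega⟩
  have hpow : (1000 : ℝ) ^ k ≤ δ ^ ((2 : ℝ) - ((k + 2 : ℕ) : ℝ)) := by
    rw [show (2 : ℝ) - ((k + 2 : ℕ) : ℝ) = -(k : ℝ) by push_cast; ring, Real.rpow_neg hδ0.le,
      Real.rpow_natCast, ← inv_pow]
    refine pow_le_pow_left₀ (by norm_num) ?_ k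
    rw [le_inv_comm₀ (by norm_num) hδ0]
    linarith
  have hG : 1 ≤ Real.Gamma (2 + (((k + 2 : ℕ) : ℝ) - 1) / 2) ^ 2 := by
    refine one_le_pow₀ ?_
    have := Real.Gamma_strictMonoOn_Ici.monotoneOn (Set.mem_Ici.2 le_rfl)
      (Set.mem_Ici.2 (show (2 : ℝ) ≤ 2 + (((k + 2 : ℕ) : ℝ) - 1) / 2 by linarith))
      (by linarith)
    rwa [Real.Gamma_two] at this
  have hπ : (1 / 2 : ℝ) ^ (k + 1) ≤ (2 / π) ^ (k + 2 - 1) := by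
    refine pow_le_pow_left₀ (by norm_num) ?_ (k + 1)
    rw [div_le_div_iff₀ two_pos pi_pos]
    linarith [Real.pi_le_four]
  have hs : 1 ≤ Real.sqrt (((k + 2 : ℕ) : ℝ) - 1) := Real.one_le_sqrt.2 (by linarith)
  have hk : 8 * (k + 1) ≤ 50 ^ k := by
    have : 10 ≤ k := by omega
    clear * - this
    induction k, this using Nat.le_induction with
    | base => norm_num
    | succ m hm ih => rw [pow_succ]; omega
  have hkR : 8 * ((k : ℝ) + 1) ≤ 50 ^ k := by exact_mod_cast hk
  calc 2 * (((k + 2 : ℕ) : ℝ) - 1) * 10 ^ (k + 2 - 2)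
      = 8 * ((k : ℝ) + 1) * 10 ^ k / 4 := by
        rw [Nat.add_sub_cancel]; push_cast; ring
    _ ≤ 50 ^ k * 10 ^ k / 4 := by gcongr
    _ = 1 / 2 * (1 / 2) ^ (k + 1) * 1 * 1000 ^ k := by
        rw [pow_succ, ← mul_pow, show (1000 : ℝ) = 2 * (50 * 10) by norm_num, mul_pow 2,
          one_div, inv_pow]
        field_simp
        norm_num
    _ ≤ _ := by gcongr

/-- For a totally real field of degree `n ≥ 12` which is `A`-reducible,
the minimum of the trace form over units is bounded by `exp(√(η² + 4(log A)²/(n-1))) · μ(a)`. -/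
theorem min_trace_over_units_bound_large_degree
    (K : Type*) [Field K] [NumberField K] (n : ℕ)
    (hdeg : Module.finrank ℚ K = n) (hn : 12 ≤ n)
    (htr : TotallyReal K) (A : ℝ) (hA : 1 ≤ A) (hred : IsAReducible K A)
    (a : K) (ha : TotPos a) :
    ∃ u : (𝓞 K)ˣ, (trForm a (u : 𝓞 K) : ℝ) ≤
      Real.exp (Real.sqrt
          ((Real.sqrt ((n : ℝ) - 1) / 2 * (2 / π) ^ (n - 1) *
              Real.Gamma (2 + ((n : ℝ) - 1) / 2) ^ 2 *
              (Real.sqrt (2 / (n : ℝ)) * (1 / 1000) *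
                  (Real.log (Real.log (n : ℝ)) / Real.log (n : ℝ)) ^ 3) ^
                ((2 : ℝ) - (n : ℝ)) *
              NumberField.Units.regulator K) ^ 2 +
            4 * Real.log A ^ 2 / ((n : ℝ) - 1))) * muMin a := by
  obtain ⟨x, hx, hmin⟩ := exists_min_trForm htr a ha
  obtain ⟨u, hu⟩ := exists_unit_place_le n hdeg (by omega) htr x hx
  refine ⟨u, ?_⟩
  set ρ := ((n : ℝ) - 1) * (Units.regulator K * 10 ^ (n - 2)) with hρ
  have h1 : (trForm a (u : 𝓞 K) : ℝ) ≤ exp (2 * ρ) * trForm a x := by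
    rw [trForm_eq_sum htr, trForm_eq_sum htr, Finset.mul_sum]
    refine Finset.sum_le_sum fun φ _ ↦ ?_
    rw [mul_left_comm, two_mul, exp_add, ← sq, ← mul_pow]
    exact mul_le_mul_of_nonneg_left (pow_le_pow_left₀ (apply_nonneg _ _) (hu _) 2) (ha _).le
  have h2 : 0 ≤ (trForm a x : ℝ) := by exact_mod_cast trForm_nonneg htr a ha x
  refine h1.trans (mul_le_mul (exp_le_exp.2 (Real.le_sqrt_of_sq_le ?_)) hmin h2 (exp_pos _).le)
  have hnR : (12 : ℝ) ≤ n := by exact_mod_cast hn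
  have hR := Units.regulator_pos K
  have h3 := mul_le_mul_of_nonneg_right (ten_pow_le_eta n hn) hR.le
  have h4 : 2 * ρ = 2 * ((n : ℝ) - 1) * 10 ^ (n - 2) * Units.regulator K := by rw [hρ]; ring
  rw [h4]
  refine le_add_of_le_of_nonneg (pow_le_pow_left₀ ?_ h3 2)
    (div_nonneg (by positivity) (by linarith))
  exact mul_nonneg (mul_nonneg (by linarith) (by positivity)) hR.le
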